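/- arXiv:2301.06513 — 2 statements merged into one kernel-verified Lean document; each statement's English description precedes it below -/
import Mathlib

section
/- Blaschke–Privaloff–Zaremba theorem in ℝⁿ: Let Ω ⊂ ℝⁿ be open and f : Ω → ℝ continuous with lim_{r→0⁺} Δ_r f(x) = 0 for every x ∈ Ω, where Δ_r f(x) = (⨍_{B_r(x)} f dλ − f(x))/r². Then f is harmonic in Ω, i.e. f is smooth and Δf = 0 in Ω. -/
open MeasureTheory Metric Filter

/-- The `r`-laplacian with respect to Lebesgue measure on `ℝⁿ`. -/
noncomputable def rLap (n : ℕ) (r : ℝ)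
    (f : EuclideanSpace ℝ (Fin n) → ℝ) (x : EuclideanSpace ℝ (Fin n)) : ℝ :=
  ((⨍ y in ball x r, f y) - f x) / r ^ 2

/-- The classical Laplacian `Δf = Σ ∂²f/∂x_i²` on Euclidean space. -/
noncomputable def classicalLaplacian (n : ℕ)
    (f : EuclideanSpace ℝ (Fin n) → ℝ) (x : EuclideanSpace ℝ (Fin n)) : ℝ :=
  ∑ i : Fin n,
    fderiv ℝ (fun y => fderiv ℝ f y (EuclideanSpace.single i 1)) x
      (EuclideanSpace.single i 1)


namespace BPZ

open Topology

abbrev EE (n : ℕ) := EuclideanSpace ℝ (Fin n)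

lemma setAverage_ball {n : ℕ} (F : EE n → ℝ) (x : EE n) {r : ℝ} (hr : 0 < r) :
    (⨍ y in ball x r, F y) = ⨍ v in ball (0 : EE n) 1, F (x + r • v) := by
  have e : ball (0 : EE n) 1 = (fun v => x + r • v) ⁻¹' (ball x r) := by
    ext v
    simp [norm_smul, abs_of_pos hr]
    constructor
    · intro h; nlinarith
    · intro h; by_contra hh; nlinarith
  rw [setAverage_eq, setAverage_eq]
  have h1 : ∫ v in ball (0 : EE n) 1, F (x + r • v)
      = (r ^ n)⁻¹ * ∫ y in ball x r, F y := by
    rw [← integral_indicator measurableSet_ball, ← integral_indicator measurableSet_ball]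
    have : (fun v => (ball (0 : EE n) 1).indicator (fun v => F (x + r • v)) v)
        = fun v => (fun w => (ball x r).indicator F (x + w)) (r • v) := by
      funext v
      rw [e]
      rfl
    rw [this, Measure.integral_comp_smul volume (fun w => (ball x r).indicator F (x + w))]
    rw [integral_add_left_eq_self (μ := volume) (fun w => (ball x r).indicator F w) x]
    simp [abs_of_pos hr]
  have h2 : volume.real (ball x r) = r ^ n * volume.real (ball (0 : EE n) 1) := by
    rw [measureReal_def, Measure.addHaar_ball_of_pos volume x hr]
    simp [measureReal_def, hr.le]
  rw [h1, h2]
  simp only [smul_eq_mul]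
  have : r ^ n ≠ 0 := by positivity
  field_simp

/-- the constant -/
noncomputable def cc (n : ℕ) : ℝ := (⨍ v in ball (0 : EE n) 1, ‖v‖ ^ 2) / (2 * n)

lemma integrableOn_ball {n : ℕ} {F : EE n → ℝ} (x : EE n) (r : ℝ) (hF : Continuous F) :
    IntegrableOn F (ball x r) :=
  (hF.continuousOn.integrableOn_compact (isCompact_closedBall x r)).mono_set ball_subset_closedBall

lemma vol_pos (n : ℕ) : 0 < volume.real (ball (0 : EE n) 1) := by
  rw [measureReal_def]
  exact ENNReal.toReal_pos (measure_ball_pos _ _ one_pos).ne' measure_ball_lt_top.ne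

lemma cc_pos {n : ℕ} (hn : 0 < n) : 0 < cc n := by
  unfold cc
  have : 0 < ∫ v in ball (0 : EE n) 1, ‖v‖ ^ 2 := by
    rw [setIntegral_pos_iff_support_of_nonneg_ae]
    · have : Nonempty (Fin n) := ⟨⟨0, hn⟩⟩
      have : Nontrivial (EE n) := inferInstanceAs (Nontrivial (EuclideanSpace ℝ (Fin n)))
      have : Function.support (fun v : EE n => ‖v‖ ^ 2) ∩ ball 0 1 = ball 0 1 \ {0} := by
        ext v; simp [and_comm]
      rw [this, measure_sdiff_null (by simp)]
      exact measure_ball_pos _ _ one_pos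
    · exact Eventually.of_forall fun v => by positivity
    · exact integrableOn_ball _ _ (by fun_prop)
  rw [setAverage_eq]
  have h := vol_pos n
  have : (0:ℝ) < n := by exact_mod_cast hn
  rw [smul_eq_mul]
  positivity

lemma setIntegral_ball_isometry {n : ℕ} (e : EE n ≃ₗᵢ[ℝ] EE n) (F : EE n → ℝ) :
    ∫ v in ball (0 : EE n) 1, F (e v) = ∫ v in ball (0 : EE n) 1, F v := by
  have := e.measurePreserving.setIntegral_preimage_emb
    e.toHomeomorph.measurableEmbedding F (ball 0 1)
  rw [← this]
  congr 2
  ext v; simp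

lemma int_odd {n : ℕ} (D : EE n →L[ℝ] ℝ) : ∫ v in ball (0 : EE n) 1, D v = 0 := by
  have := setIntegral_ball_isometry (LinearIsometryEquiv.neg ℝ (E := EE n)) D
  simp [integral_neg] at this
  linarith

lemma int_cross {n : ℕ} {i j : Fin n} (hij : i ≠ j) :
    ∫ v in ball (0 : EE n) 1, v i * v j = 0 := by
  let e : EE n ≃ₗᵢ[ℝ] EE n := LinearIsometryEquiv.piLpCongrRight 2
    (fun k => if k = i then LinearIsometryEquiv.neg ℝ (E := ℝ) else LinearIsometryEquiv.refl ℝ ℝ)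
  have := setIntegral_ball_isometry e (fun v => v i * v j)
  have h1 : ∀ v : EE n, (e v) i = - v i := by intro v; simp [e]
  have h2 : ∀ v : EE n, (e v) j = v j := by intro v; simp [e, hij.symm]
  simp only [h1, h2, neg_mul, integral_neg] at this
  linarith

lemma int_sq {n : ℕ} (i : Fin n) :
    ⨍ v in ball (0 : EE n) 1, v i * v i = 2 * cc n := by
  have hs : ∀ j : Fin n, ∫ v in ball (0 : EE n) 1, v j * v j
      = ∫ v in ball (0 : EE n) 1, v i * v i := by
    intro j
    have := setIntegral_ball_isometry
      (LinearIsometryEquiv.piLpCongrLeft 2 ℝ ℝ (Equiv.swap i j)) (fun v : EE n => v i * v i)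
    rw [← this]
    simp [LinearIsometryEquiv.piLpCongrLeft_apply, Equiv.piCongrLeft']
  have hn : (n : ℝ) ≠ 0 := by
    have := i.pos
    positivity
  have : ∫ v in ball (0 : EE n) 1, ‖v‖ ^ 2 = n * ∫ v in ball (0 : EE n) 1, v i * v i := by
    simp_rw [EuclideanSpace.real_norm_sq_eq, pow_two]
    rw [integral_finsetSum]
    · simp [hs]
    · intro j _
      exact integrableOn_ball _ _ (by fun_prop)
  unfold cc
  rw [setAverage_eq, setAverage_eq, this]
  simp only [smul_eq_mul]
  field_simp

lemma avg_bilin {n : ℕ} (B : EE n →L[ℝ] EE n →L[ℝ] ℝ) :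
    ⨍ v in ball (0 : EE n) 1, B v v
      = 2 * cc n * ∑ i, B (EuclideanSpace.single i 1) (EuclideanSpace.single i 1) := by
  have h : ∀ v : EE n, B v v = ∑ i, ∑ j, B (EuclideanSpace.single i 1)
      (EuclideanSpace.single j 1) * (v i * v j) := by
    intro v
    have hv : v = ∑ i, v i • (EuclideanSpace.single i 1 : EE n) := by
      ext k; simp [Finset.sum_apply, Pi.single_apply]
    conv_lhs => rw [hv]
    simp only [map_sum, map_smul, _root_.sum_apply, _root_.smul_apply,
      smul_eq_mul, Finset.mul_sum]
    rw [Finset.sum_comm]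
    refine Finset.sum_congr rfl fun i _ => Finset.sum_congr rfl fun j _ => by ring
  rw [setAverage_congr_fun measurableSet_ball (Eventually.of_forall fun v _ => h v)]
  rw [setAverage_eq, integral_finsetSum]
  swap
  · intro i _
    exact integrableOn_ball _ _ (by fun_prop)
  rw [Finset.smul_sum, Finset.mul_sum]
  refine Finset.sum_congr rfl fun i _ => ?_
  rw [integral_finsetSum]
  swap
  · intro j _
    exact integrableOn_ball _ _ (by fun_prop)
  simp_rw [integral_const_mul]
  rw [Finset.sum_eq_single i]
  · rw [← int_sq i, setAverage_eq]
    simp only [smul_eq_mul]; ring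
  · intro j _ hj
    rw [int_cross hj.symm, mul_zero]
  · simp

lemma taylor2 {n : ℕ} {f : EE n → ℝ} {x : EE n} (hf : ContDiffAt ℝ 2 f x) {ε : ℝ} (hε : 0 < ε) :
    ∃ δ > 0, ∀ v : EE n, ‖v‖ < δ →
      ‖f (x + v) - f x - fderiv ℝ f x v - (1/2) * fderiv ℝ (fderiv ℝ f) x v v‖ ≤ ε * ‖v‖ ^ 2 := by
  have hd : DifferentiableAt ℝ (fderiv ℝ f) x :=
    (hf.fderiv_right (m := 1) (by norm_num)).differentiableAt (by norm_num)
  have hsym : IsSymmSndFDerivAt ℝ f x := hf.isSymmSndFDerivAt (by simp)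
  have h1 := hd.hasFDerivAt.isLittleO.bound hε 
  have h2 : ∀ᶠ y in 𝓝 x, DifferentiableAt ℝ f y := by
    filter_upwards [hf.eventually (by simp)] with y hy
    exact hy.differentiableAt (by norm_num)
  obtain ⟨δ, hδ, h⟩ := Metric.eventually_nhds_iff_ball.1 (h1.and h2)
  refine ⟨δ, hδ, fun v hv => ?_⟩
  set B := fderiv ℝ (fderiv ℝ f) x
  set g : EE n → ℝ := fun w => f (x + w) - f x - fderiv ℝ f x w - (1/2) * B w w
  have hg : ∀ w ∈ closedBall (0 : EE n) ‖v‖, HasFDerivWithinAt g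
      (fderiv ℝ f (x + w) - fderiv ℝ f x - B w) (closedBall 0 ‖v‖) w := by
    intro w hw
    have hw' : x + w ∈ ball x δ := by
      simp at hw ⊢; linarith
    have a1 : HasFDerivAt (fun w => f (x + w)) (fderiv ℝ f (x + w)) w := by
      have := (h _ hw').2.hasFDerivAt
      exact (hasFDerivAt_comp_add_left x).2 this
    have a2 : HasFDerivAt (fun w => B w w) (B w + B.flip w) w := by
      have := (B.hasFDerivAt (x := w)).clm_apply (hasFDerivAt_id w)
      exact this
    have a3 : B.flip w = B w := by
      ext u; exact hsym u w
    have := ((a1.sub_const (f x)).sub (fderiv ℝ f x).hasFDerivAt).sub (a2.const_mul (1/2))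
    refine HasFDerivAt.hasFDerivWithinAt ?_
    refine this.congr_fderiv ?_
    rw [a3]
    ext u; simp; ring
  have := (convex_closedBall (0 : EE n) ‖v‖).norm_image_sub_le_of_norm_hasFDerivWithin_le
    (C := ε * ‖v‖) hg ?_ (mem_closedBall_self (norm_nonneg v)) (y := v) (by simp)
  · have g0 : g 0 = 0 := by simp [g]
    rw [g0, sub_zero, sub_zero] at this
    calc _ = ‖g v‖ := rfl
      _ ≤ _ := this
      _ = _ := by ring
  · intro w hw
    have hw' : x + w ∈ ball x δ := by
      simp at hw ⊢; linarith
    have := (h _ hw').1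
    simp only [add_sub_cancel_left] at this
    refine this.trans ?_
    simp at hw
    gcongr

lemma rLap_tendsto {n : ℕ} {f : EE n → ℝ} {x : EE n} (hf : ContDiffAt ℝ 2 f x) :
    Tendsto (fun r => rLap n r f x) (𝓝[>] 0) (𝓝 (cc n * classicalLaplacian n f x)) := by
  have hd : DifferentiableAt ℝ (fderiv ℝ f) x :=
    (hf.fderiv_right (m := 1) (by norm_num)).differentiableAt (by norm_num)
  set B := fderiv ℝ (fderiv ℝ f) x with hB
  set D := fderiv ℝ f x with hD
  have hlap : classicalLaplacian n f x
      = ∑ i, B (EuclideanSpace.single i 1) (EuclideanSpace.single i 1) := by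
    unfold classicalLaplacian
    refine Finset.sum_congr rfl fun i _ => ?_
    rw [fderiv_clm_apply hd (by fun_prop)]
    simp [hB]
  have hcont : ∀ᶠ y in 𝓝 x, ContinuousAt f y := by
    filter_upwards [hf.eventually (by simp)] with y hy
    exact hy.continuousAt
  obtain ⟨δ₀, hδ₀, hcont⟩ := Metric.eventually_nhds_iff_ball.1 hcont
  have hV := vol_pos n
  rw [Metric.tendsto_nhds]
  intro ε hε
  obtain ⟨δ, hδ, ht⟩ := taylor2 hf (half_pos hε)
  filter_upwards [Ioo_mem_nhdsGT (lt_min hδ hδ₀)] with r hr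
  obtain ⟨hr0, hr1⟩ := hr
  have hrδ : r < δ := hr1.trans_le (min_le_left _ _)
  have hrδ₀ : r < δ₀ := hr1.trans_le (min_le_right _ _)
  have hfi : IntegrableOn (fun v => f (x + r • v)) (ball (0 : EE n) 1) := by
    refine (ContinuousOn.integrableOn_compact (isCompact_closedBall (0 : EE n) 1) ?_).mono_set
      ball_subset_closedBall
    intro v hv
    have : x + r • v ∈ ball x δ₀ := by
      simp [norm_smul, abs_of_pos hr0] at hv ⊢
      nlinarith
    refine ContinuousAt.continuousWithinAt ?_
    exact ContinuousAt.comp (g := f) (hcont _ this) (by fun_prop)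
  have key : rLap n r f x - cc n * classicalLaplacian n f x
      = ⨍ v in ball (0 : EE n) 1,
        (f (x + r • v) - f x - D (r • v) - (1/2) * B (r • v) (r • v)) / r ^ 2 := by
    have e1 : (⨍ v in ball (0 : EE n) 1, B v v) = 2 * cc n * classicalLaplacian n f x := by
      rw [avg_bilin, hlap]
    have e2 : cc n * classicalLaplacian n f x = (1/2) * (⨍ v in ball (0 : EE n) 1, B v v) := by
      rw [e1]; ring
    rw [rLap, setAverage_ball f x hr0, e2]
    simp only [setAverage_eq, smul_eq_mul]
    rw [integral_div]
    have c1 : IntegrableOn (fun v => f x) (ball (0 : EE n) 1) :=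
      integrableOn_ball _ _ (by fun_prop)
    have c2 : IntegrableOn (fun v => D (r • v)) (ball (0 : EE n) 1) :=
      integrableOn_ball _ _ (by fun_prop)
    have c3 : IntegrableOn (fun v => (1/2) * B (r • v) (r • v)) (ball (0 : EE n) 1) :=
      integrableOn_ball _ _ (by fun_prop)
    have d1 : IntegrableOn (fun v => f (x + r • v) - f x) (ball (0 : EE n) 1) := hfi.sub c1
    have d2 : IntegrableOn (fun v => f (x + r • v) - f x - D (r • v)) (ball (0 : EE n) 1) :=
      d1.sub c2
    rw [integral_sub d2 c3, integral_sub d1 c2, integral_sub hfi c1,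
      integral_const_mul]
    simp only [map_smul, _root_.smul_apply, smul_eq_mul, integral_const_mul, int_odd,
      setIntegral_const]
    field_simp
    ring
  rw [Real.dist_eq, key, setAverage_eq, smul_eq_mul, abs_mul, abs_of_pos (inv_pos.2 hV)]
  have := norm_setIntegral_le_of_norm_le_const (μ := volume) (s := ball (0 : EE n) 1)
    (f := fun v => (f (x + r • v) - f x - D (r • v) - (1/2) * B (r • v) (r • v)) / r ^ 2)
    (C := ε / 2) measure_ball_lt_top ?_
  · rw [Real.norm_eq_abs] at this
    calc _ ≤ (volume.real (ball (0 : EE n) 1))⁻¹ * (ε / 2 * volume.real (ball (0 : EE n) 1)) := by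
          gcongr
      _ = ε / 2 := by field_simp
      _ < ε := by linarith
  · intro v hv
    simp at hv
    have hn : ‖r • v‖ ≤ r := by
      rw [norm_smul, Real.norm_eq_abs, abs_of_pos hr0]; nlinarith
    have := ht (r • v) (hn.trans_lt hrδ)
    rw [norm_div, Real.norm_eq_abs (r ^ 2), abs_of_pos (by positivity : 0 < r^2),
      div_le_iff₀ (by positivity)]
    refine this.trans ?_
    gcongr

end BPZ

namespace BPZ

open Topology

/-- Maximum principle for functions with vanishing asymptotic mean value Laplacian. -/
lemma max_principle {n : ℕ} (hn : 0 < n) {u : EE n → ℝ} {a : EE n} {R M : ℝ}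
    (hR : 0 < R)
    (hu : ContinuousOn u (closedBall a R))
    (hlap : ∀ x ∈ ball a R, Tendsto (fun r => rLap n r u x) (𝓝[>] 0) (𝓝 0))
    (hM : ∀ x ∈ sphere a R, u x ≤ M) : ∀ x ∈ closedBall a R, u x ≤ M := by
  intro x hx
  refine le_of_forall_pos_le_add fun η hη => ?_
  set ε := η / R ^ 2 with hε
  have hεpos : 0 < ε := by positivity
  set q : EE n → ℝ := fun y => ‖y - a‖ ^ 2 with hq
  have hqc : ContDiff ℝ 2 q := by
    simp only [hq]
    exact (contDiff_id.sub contDiff_const).norm_sq ℝ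
  have hqlap : ∀ y, classicalLaplacian n q y = 2 * n := by
    intro y
    have h1 : ∀ z v : EE n, fderiv ℝ q z v = 2 * inner ℝ (z - a) v := by
      intro z v
      have := ((hasFDerivAt_id z).sub_const a).norm_sq
      have h2 : fderiv ℝ q z = _ := this.fderiv
      rw [h2]
      simp [inner_sub_left]
    unfold classicalLaplacian
    simp only [h1]
    have h3 : ∀ i : Fin n, HasFDerivAt (fun z : EE n => 2 * inner ℝ (z - a) (EuclideanSpace.single i (1:ℝ)))
        ((2 : ℝ) • (EuclideanSpace.proj i : EE n →L[ℝ] ℝ)) y := by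
      intro i
      have : (fun z : EE n => 2 * inner ℝ (z - a) (EuclideanSpace.single i (1:ℝ)))
          = fun z : EE n => (2 : ℝ) • ((EuclideanSpace.proj i : EE n →L[ℝ] ℝ) z - a i) := by
        funext z
        simp [EuclideanSpace.inner_single_right]
      rw [this]
      exact ((EuclideanSpace.proj i : EE n →L[ℝ] ℝ).hasFDerivAt.sub_const (a i)).const_smul (2 : ℝ)
    simp only [fun i => (h3 i).fderiv]
    simp
    ring
  set w : EE n → ℝ := fun y => u y + ε * q y with hw
  have hwc : ContinuousOn w (closedBall a R) :=
    hu.add (continuousOn_const.mul hqc.continuous.continuousOn)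
  obtain ⟨x₀, hx₀, hmax⟩ := (isCompact_closedBall a R).exists_isMaxOn ⟨x, hx⟩ hwc
  have hmax : ∀ y ∈ closedBall a R, w y ≤ w x₀ := hmax
  by_cases hb : x₀ ∈ ball a R
  · exfalso
    have hlim : Tendsto (fun r => rLap n r u x₀ + ε * rLap n r q x₀) (𝓝[>] 0)
        (𝓝 (0 + ε * (cc n * (2 * n)))) := by
      have := rLap_tendsto (hqc.contDiffAt (x := x₀))
      rw [hqlap] at this
      exact (hlap x₀ hb).add (this.const_mul ε)
    obtain ⟨δ, hδ, hδb⟩ := Metric.isOpen_iff.1 isOpen_ball x₀ hb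
    have hle : ∀ᶠ r in 𝓝[>] (0:ℝ), rLap n r u x₀ + ε * rLap n r q x₀ ≤ 0 := by
      filter_upwards [Ioo_mem_nhdsGT hδ] with r hr
      obtain ⟨hr0, hr1⟩ := hr
      have hsub : ball x₀ r ⊆ closedBall a R :=
        (ball_subset_ball hr1.le).trans (hδb.trans ball_subset_closedBall)
      have i1 : IntegrableOn u (ball x₀ r) :=
        (hu.integrableOn_compact (isCompact_closedBall a R)).mono_set hsub
      have i2 : IntegrableOn (fun y => ε * q y) (ball x₀ r) :=
        integrableOn_ball _ _ (continuous_const.mul hqc.continuous)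
      have hV : 0 < volume.real (ball x₀ r) := by
        rw [measureReal_def]
        exact ENNReal.toReal_pos (measure_ball_pos _ _ hr0).ne' measure_ball_lt_top.ne
      have hI : ∫ y in ball x₀ r, w y ≤ volume.real (ball x₀ r) * w x₀ := by
        have := setIntegral_mono_on (i1.add i2)
          (integrableOn_ball x₀ r (continuous_const (y := w x₀))) measurableSet_ball
          (fun y hy => hmax y (hsub hy))
        simpa using this
      have hS : ∫ y in ball x₀ r, w y
          = (∫ y in ball x₀ r, u y) + ε * ∫ y in ball x₀ r, q y := by
        rw [← integral_const_mul, ← integral_add i1 i2]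
      have : rLap n r u x₀ + ε * rLap n r q x₀
          = ((volume.real (ball x₀ r))⁻¹ * (∫ y in ball x₀ r, w y) - w x₀) / r ^ 2 := by
        rw [hS]
        simp only [rLap, setAverage_eq, smul_eq_mul, hw]
        ring
      rw [this]
      refine div_nonpos_of_nonpos_of_nonneg ?_ (by positivity)
      rw [sub_nonpos, inv_mul_le_iff₀ hV]
      exact hI
    have := le_of_tendsto hlim hle
    have hc := cc_pos hn
    have hn' : (0:ℝ) < n := by exact_mod_cast hn
    have : 0 < ε * (cc n * (2 * n)) := by positivity
    linarith
  · have hs : x₀ ∈ sphere a R := by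
      rw [mem_ball, not_lt] at hb
      exact le_antisymm hx₀ hb
    have h1 := hmax x hx
    have h2 := hM x₀ hs
    have h3 : q x₀ = R ^ 2 := by
      simp only [hq]; rw [← dist_eq_norm, mem_sphere.1 hs]
    have h4 : 0 ≤ ε * q x := by positivity
    have h5 : ε * R ^ 2 = η := by rw [hε]; field_simp
    simp only [hw] at h1
    rw [h3, h5] at h1
    linarith

end BPZ

namespace BPZ

open Topology

/-- polynomial function on Euclidean space -/
noncomputable def pe {n : ℕ} (p : MvPolynomial (Fin n) ℝ) (x : EE n) : ℝ :=
  MvPolynomial.eval (fun i => x i) p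

/-- formal Laplacian -/
noncomputable def pLap (n : ℕ) : MvPolynomial (Fin n) ℝ →ₗ[ℝ] MvPolynomial (Fin n) ℝ :=
  ∑ i, (MvPolynomial.pderiv i).toLinearMap ∘ₗ (MvPolynomial.pderiv i).toLinearMap

lemma pLap_apply {n : ℕ} (p : MvPolynomial (Fin n) ℝ) :
    pLap n p = ∑ i, MvPolynomial.pderiv i (MvPolynomial.pderiv i p) := by
  simp [pLap]

lemma pe_hasFDerivAt {n : ℕ} (p : MvPolynomial (Fin n) ℝ) (x : EE n) :
    HasFDerivAt (pe p) (∑ i, pe (MvPolynomial.pderiv i p) x •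
      (EuclideanSpace.proj i : EE n →L[ℝ] ℝ)) x := by
  induction p using MvPolynomial.induction_on with
  | C a =>
    have : pe (MvPolynomial.C a : MvPolynomial (Fin n) ℝ) = fun _ => a := by
      funext y; simp [pe]
    rw [this]
    refine (hasFDerivAt_const a x).congr_fderiv ?_
    simp [pe]
  | add p q hp hq =>
    have : pe (p + q) = fun y => pe p y + pe q y := by
      funext y; simp [pe]
    rw [this]
    refine (hp.add hq).congr_fderiv ?_
    simp [pe, add_smul, Finset.sum_add_distrib]
  | mul_X p j hp =>
    have : pe (p * MvPolynomial.X j) = fun y => pe p y * (EuclideanSpace.proj j : EE n →L[ℝ] ℝ) y := by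
      funext y; simp [pe]
    rw [this]
    refine (hp.mul (EuclideanSpace.proj j : EE n →L[ℝ] ℝ).hasFDerivAt).congr_fderiv ?_
    ext v
    simp [pe, MvPolynomial.pderiv_X, Pi.single_apply, Finset.mul_sum, add_mul, Finset.sum_add_distrib,
      apply_ite]
    refine Finset.sum_congr rfl fun i _ => by ring

lemma pe_contDiff {n : ℕ} (p : MvPolynomial (Fin n) ℝ) {k : WithTop ℕ∞} : ContDiff ℝ k (pe p) := by
  induction p using MvPolynomial.induction_on with
  | C a =>
    have : pe (MvPolynomial.C a : MvPolynomial (Fin n) ℝ) = fun _ => a := by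
      funext y; simp [pe]
    rw [this]; exact contDiff_const
  | add p q hp hq =>
    have : pe (p + q) = fun y => pe p y + pe q y := by
      funext y; simp [pe]
    rw [this]; exact hp.add hq
  | mul_X p j hp =>
    have : pe (p * MvPolynomial.X j) = fun y => pe p y * (EuclideanSpace.proj j : EE n →L[ℝ] ℝ) y := by
      funext y; simp [pe]
    rw [this]; exact hp.mul (ContinuousLinearMap.contDiff _)

lemma pe_fderiv {n : ℕ} (p : MvPolynomial (Fin n) ℝ) (x : EE n) (i : Fin n) :
    fderiv ℝ (pe p) x (EuclideanSpace.single i 1) = pe (MvPolynomial.pderiv i p) x := by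
  rw [(pe_hasFDerivAt p x).fderiv]
  simp

lemma pe_lap {n : ℕ} (p : MvPolynomial (Fin n) ℝ) (x : EE n) :
    classicalLaplacian n (pe p) x = pe (pLap n p) x := by
  unfold classicalLaplacian
  simp only [pe_fderiv, pLap_apply]
  simp [pe]

lemma totalDegree_pderiv_le {n : ℕ} (p : MvPolynomial (Fin n) ℝ) (i : Fin n) :
    (MvPolynomial.pderiv i p).totalDegree ≤ p.totalDegree - 1 := by
  conv_lhs => rw [p.as_sum]
  rw [map_sum]
  refine MvPolynomial.totalDegree_finsetSum_le fun s hs => ?_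
  rw [MvPolynomial.pderiv_monomial]
  by_cases h : s i = 0
  · simp [h]
  · refine (MvPolynomial.totalDegree_monomial_le _ _).trans ?_
    have h1 : (s.sum fun _ e => e) ≤ p.totalDegree := MvPolynomial.le_totalDegree hs
    have h2 : s = (s - Finsupp.single i 1) + Finsupp.single i 1 := by
      rw [tsub_add_cancel_of_le]
      simpa using Nat.one_le_iff_ne_zero.2 h
    have h3 : s.degree = (s - Finsupp.single i 1).degree + 1 := by
      conv_lhs => rw [h2]
      simp
    have h4 : ∀ t : Fin n →₀ ℕ, (t.sum fun _ e => e) = t.degree := by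
      intro t; rfl
    simp only [h4] at *
    change (s - Finsupp.single i 1).degree ≤ _
    omega

lemma totalDegree_pLap_le {n : ℕ} (p : MvPolynomial (Fin n) ℝ) :
    (pLap n p).totalDegree ≤ p.totalDegree - 2 := by
  rw [pLap_apply]
  refine MvPolynomial.totalDegree_finsetSum_le fun i _ => ?_
  have h1 := totalDegree_pderiv_le (MvPolynomial.pderiv i p) i
  have h2 := totalDegree_pderiv_le p i
  omega

/-- the polynomial `R² - |x - a|²` -/
noncomputable def qq {n : ℕ} (a : EE n) (R : ℝ) : MvPolynomial (Fin n) ℝ :=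
  MvPolynomial.C (R ^ 2) - ∑ i, (MvPolynomial.X i - MvPolynomial.C (a i)) ^ 2

lemma pe_qq {n : ℕ} (a x : EE n) (R : ℝ) : pe (qq a R) x = R ^ 2 - ‖x - a‖ ^ 2 := by
  rw [EuclideanSpace.real_norm_sq_eq]
  simp [pe, qq]

lemma totalDegree_qq {n : ℕ} (a : EE n) (R : ℝ) : (qq a R).totalDegree ≤ 2 := by
  refine (MvPolynomial.totalDegree_sub _ _).trans (max_le (by rw [MvPolynomial.totalDegree_C]; omega) ?_)
  refine MvPolynomial.totalDegree_finsetSum_le fun i _ => ?_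
  refine (MvPolynomial.totalDegree_pow _ _).trans ?_
  have : (MvPolynomial.X i - MvPolynomial.C (a i) : MvPolynomial (Fin n) ℝ).totalDegree ≤ 1 :=
    (MvPolynomial.totalDegree_sub _ _).trans (max_le (by simp) (by simp))
  omega

lemma pe_mul {n : ℕ} (p q : MvPolynomial (Fin n) ℝ) (x : EE n) : pe (p * q) x = pe p x * pe q x := by
  simp [pe]

lemma pe_eq_zero {n : ℕ} {p : MvPolynomial (Fin n) ℝ} {a : EE n} {R : ℝ} (hR : 0 < R)
    (h : ∀ x ∈ ball a R, pe p x = 0) : p = 0 := by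
  have hop : IsOpen ((fun v : Fin n → ℝ => (WithLp.toLp 2 v : EE n)) ⁻¹' (ball a R)) :=
    isOpen_ball.preimage (PiLp.continuous_toLp 2 _)
  obtain ⟨δ, hδ, hb⟩ := Metric.isOpen_iff.1 hop (fun i => a i) (by
    simpa using hR)
  refine MvPolynomial.funext_set (fun i => ball (a i) δ) (fun i => ?_) fun v hv => ?_
  · rw [Real.ball_eq_Ioo]; exact Set.Ioo_infinite (by linarith)
  · have : v ∈ ball (fun i => a i) δ := by
      rw [ball_pi _ hδ]; exact hv
    simpa [pe] using h _ (hb this)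

lemma rLap_pe {n : ℕ} {p : MvPolynomial (Fin n) ℝ} (hp : pLap n p = 0) (x : EE n) :
    Tendsto (fun r => rLap n r (pe p) x) (𝓝[>] 0) (𝓝 0) := by
  have := rLap_tendsto ((pe_contDiff p (k := 2)).contDiffAt (x := x))
  rw [pe_lap, hp] at this
  simpa [pe] using this

lemma pe_neg {n : ℕ} (p : MvPolynomial (Fin n) ℝ) (x : EE n) : pe (-p) x = - pe p x := by
  simp [pe]

/-- Dirichlet problem on balls for polynomial data. -/
lemma dirichlet_poly {n : ℕ} (hn : 0 < n) (p : MvPolynomial (Fin n) ℝ) (a : EE n) {R : ℝ}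
    (hR : 0 < R) : ∃ h : MvPolynomial (Fin n) ℝ, pLap n h = 0 ∧
      ∀ x ∈ sphere a R, pe h x = pe p x := by
  set m := p.totalDegree
  let V := MvPolynomial.restrictTotalDegree (Fin n) ℝ m
  have hsph : ∀ u : MvPolynomial (Fin n) ℝ, ∀ x ∈ sphere a R, pe (qq a R * u) x = 0 := by
    intro u x hx
    rw [pe_mul, pe_qq, ← dist_eq_norm, mem_sphere.1 hx]; simp
  let T₀ : MvPolynomial (Fin n) ℝ →ₗ[ℝ] MvPolynomial (Fin n) ℝ :=
    pLap n ∘ₗ LinearMap.mulLeft ℝ (qq a R)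
  have hT₀ : ∀ u, T₀ u = pLap n (qq a R * u) := fun u => rfl
  have hmap : ∀ u ∈ V, T₀ u ∈ V := by
    intro u hu
    rw [MvPolynomial.mem_restrictTotalDegree] at hu ⊢
    rw [hT₀]
    have h1 := totalDegree_pLap_le (qq a R * u)
    have h2 := MvPolynomial.totalDegree_mul (qq a R) u
    have h3 := totalDegree_qq a R
    omega
  let T : V →ₗ[ℝ] V := T₀.restrict hmap
  have hinj : Function.Injective T := by
    rw [← LinearMap.ker_eq_bot, LinearMap.ker_eq_bot']
    rintro ⟨u, hu⟩ hTu
    have h0 : pLap n (qq a R * u) = 0 := by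
      have := congrArg Subtype.val hTu
      exact this
    have hle : ∀ x ∈ closedBall a R, pe (qq a R * u) x ≤ 0 :=
      max_principle hn hR (pe_contDiff _ (k := 0)).continuous.continuousOn (fun x _ => rLap_pe h0 x)
        (fun x hx => (hsph u x hx).le)
    have h0' : pLap n (-(qq a R * u)) = 0 := by rw [map_neg, h0, neg_zero]
    have hge : ∀ x ∈ closedBall a R, pe (-(qq a R * u)) x ≤ 0 :=
      max_principle hn hR (pe_contDiff _ (k := 0)).continuous.continuousOn (fun x _ => rLap_pe h0' x)
        (fun x hx => by rw [pe_neg, hsph u x hx, neg_zero])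
    have hz : u = 0 := by
      refine pe_eq_zero hR (a := a) fun x hx => ?_
      have h1 := hle x (ball_subset_closedBall hx)
      have h2 := hge x (ball_subset_closedBall hx)
      rw [pe_neg] at h2
      have h3 : pe (qq a R) x * pe u x = 0 := by rw [← pe_mul]; linarith
      have h4 : 0 < pe (qq a R) x := by
        rw [pe_qq]
        rw [mem_ball, dist_eq_norm] at hx
        nlinarith [norm_nonneg (x - a)]
      exact (mul_eq_zero.1 h3).resolve_left h4.ne'
    subst hz
    rfl
  have hsurj : Function.Surjective T := LinearMap.injective_iff_surjective.1 hinj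
  have hp : - pLap n p ∈ V := by
    rw [MvPolynomial.mem_restrictTotalDegree, MvPolynomial.totalDegree_neg]
    have := totalDegree_pLap_le p
    omega
  obtain ⟨⟨u, hu⟩, hTu⟩ := hsurj ⟨_, hp⟩
  have h0 : pLap n (qq a R * u) = - pLap n p := congrArg Subtype.val hTu
  refine ⟨p + qq a R * u, by rw [map_add, h0, add_neg_cancel], fun x hx => ?_⟩
  have := hsph u x hx
  simp only [pe, map_add] at this ⊢
  rw [this, add_zero]

end BPZ

namespace BPZ

open Topology

/-- The radial potential. -/
noncomputable def psi {n : ℕ} (y : EE n) : ℝ := -(1/2) * expNegInvGlue (1 - ‖y‖ ^ 2)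

/-- The radial kernel. -/
noncomputable def phi {n : ℕ} (y : EE n) : ℝ := deriv expNegInvGlue (1 - ‖y‖ ^ 2)

lemma phi_contDiff {n : ℕ} : ContDiff ℝ (⊤ : ℕ∞) (phi (n := n)) := by
  have h : ContDiff ℝ (⊤ : ℕ∞) (deriv expNegInvGlue) :=
    (contDiff_infty_iff_deriv.1 expNegInvGlue.contDiff).2
  exact h.comp (contDiff_const.sub (contDiff_norm_sq ℝ))

lemma phi_nonneg {n : ℕ} (y : EE n) : 0 ≤ phi y := expNegInvGlue.monotone.deriv_nonneg

lemma one_sub_neg {n : ℕ} {y : EE n} (hy : y ∉ closedBall (0 : EE n) 1) : 1 - ‖y‖ ^ 2 < 0 := by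
  simp at hy
  nlinarith

lemma phi_zero {n : ℕ} {y : EE n} (hy : y ∉ closedBall (0 : EE n) 1) : phi y = 0 := by
  have h := one_sub_neg hy
  have : expNegInvGlue =ᶠ[𝓝 (1 - ‖y‖ ^ 2)] fun _ => 0 := by
    filter_upwards [Iio_mem_nhds h] with s hs
    exact expNegInvGlue.zero_of_nonpos (le_of_lt hs)
  rw [phi, this.deriv_eq]
  simp

lemma psi_zero {n : ℕ} {y : EE n} (hy : y ∉ closedBall (0 : EE n) 1) : psi y = 0 := by
  rw [psi, expNegInvGlue.zero_of_nonpos (one_sub_neg hy).le, mul_zero]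

lemma phi_supp {n : ℕ} : HasCompactSupport (phi (n := n)) :=
  HasCompactSupport.intro (isCompact_closedBall 0 1) fun _ h => phi_zero h

lemma psi_supp {n : ℕ} : HasCompactSupport (psi (n := n)) :=
  HasCompactSupport.intro (isCompact_closedBall 0 1) fun _ h => psi_zero h

lemma psi_hasFDerivAt {n : ℕ} (y : EE n) :
    HasFDerivAt psi (phi y • (innerSL ℝ y : EE n →L[ℝ] ℝ)) y := by
  have h1 : HasFDerivAt (fun y : EE n => 1 - ‖y‖ ^ 2) (-(2 • (innerSL ℝ y : EE n →L[ℝ] ℝ))) y :=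
    ((hasStrictFDerivAt_norm_sq y).hasFDerivAt).const_sub 1
  have h2 : HasDerivAt expNegInvGlue (phi y) (1 - ‖y‖ ^ 2) :=
    ((expNegInvGlue.contDiff (n := 1)).differentiable (by norm_num) _).hasDerivAt
  refine ((h2.comp_hasFDerivAt y h1).const_mul (-(1/2))).congr_fderiv ?_
  ext v
  simp
  ring

lemma psi_fderiv {n : ℕ} (y : EE n) (i : Fin n) :
    fderiv ℝ psi y (EuclideanSpace.single i 1) = phi y * y i := by
  rw [(psi_hasFDerivAt y).fderiv]
  simp [EuclideanSpace.inner_single_right]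

lemma phi_int_pos {n : ℕ} (hn : 0 < n) : 0 < ∫ y : EE n, phi y := by
  obtain ⟨c, hc, hd⟩ := exists_deriv_eq_slope expNegInvGlue (zero_lt_one (α := ℝ))
    (expNegInvGlue.contDiff (n := 1)).continuous.continuousOn
    ((expNegInvGlue.contDiff (n := 1)).differentiable (by norm_num)).differentiableOn
  have h1 : 0 < deriv expNegInvGlue c := by
    rw [hd, expNegInvGlue.zero]
    simpa using expNegInvGlue.pos_of_pos one_pos
  refine phi_contDiff.continuous.integral_pos_of_hasCompactSupport_nonneg_nonzero phi_supp
    phi_nonneg (x := EuclideanSpace.single ⟨0, hn⟩ (√(1 - c))) ?_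
  have : ‖(EuclideanSpace.single ⟨0, hn⟩ (√(1 - c)) : EE n)‖ ^ 2 = 1 - c := by
    simp [Real.sq_sqrt (sub_nonneg.2 hc.2.le)]
  rw [phi, this]
  simpa using h1.ne'

lemma pe_continuous {n : ℕ} (p : MvPolynomial (Fin n) ℝ) : Continuous (pe p) :=
  (pe_contDiff p (k := 0)).continuous

lemma psi_continuous {n : ℕ} : Continuous (psi (n := n)) :=
  continuous_iff_continuousAt.2 fun y => (psi_hasFDerivAt y).continuousAt

lemma integrable_mul_phi {n : ℕ} {F : EE n → ℝ} (hF : Continuous F) :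
    Integrable (fun y => F y * phi y) :=
  (hF.mul phi_contDiff.continuous).integrable_of_hasCompactSupport phi_supp.mul_left

lemma integrable_mul_psi {n : ℕ} {F : EE n → ℝ} (hF : Continuous F) :
    Integrable (fun y => F y * psi y) :=
  (hF.mul psi_continuous).integrable_of_hasCompactSupport psi_supp.mul_left

lemma ibp {n : ℕ} (q : MvPolynomial (Fin n) ℝ) (x : EE n) (t : ℝ) (i : Fin n) :
    ∫ y, pe q (x + t • y) * y i * phi y
      = - (t * ∫ y, pe (MvPolynomial.pderiv i q) (x + t • y) * psi y) := by
  have hd : ∀ y : EE n, HasFDerivAt (fun y => pe q (x + t • y))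
      ((fderiv ℝ (pe q) (x + t • y)).comp (t • ContinuousLinearMap.id ℝ (EE n))) y := by
    intro y
    have h1 : HasFDerivAt (fun y : EE n => x + t • y) (t • ContinuousLinearMap.id ℝ (EE n)) y :=
      ((hasFDerivAt_id y).const_smul t).const_add x
    exact ((pe_hasFDerivAt q (x + t • y)).differentiableAt.hasFDerivAt).comp y h1
  have hd' : ∀ y : EE n, fderiv ℝ (fun y => pe q (x + t • y)) y (EuclideanSpace.single i 1)
      = t * pe (MvPolynomial.pderiv i q) (x + t • y) := by
    intro y
    rw [(hd y).fderiv]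
    simp only [ContinuousLinearMap.comp_apply, _root_.smul_apply, map_smul, smul_eq_mul,
      ContinuousLinearMap.id_apply, pe_fderiv]
  have hq := pe_continuous q
  have hq' := pe_continuous (MvPolynomial.pderiv i q)
  have := integral_mul_fderiv_eq_neg_fderiv_mul_of_integrable (μ := (volume : Measure (EE n)))
    (f := fun y => pe q (x + t • y)) (g := psi) (v := EuclideanSpace.single i 1) ?_ ?_ ?_
    (fun y _ => (hd y).differentiableAt) (fun y _ => (psi_hasFDerivAt y).differentiableAt)
  · simp only [hd', psi_fderiv] at this
    rw [← integral_const_mul]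
    convert this using 1
    · congr 1; funext y; ring
    · congr 2; funext y; ring
  · simp only [hd']
    exact integrable_mul_psi (by fun_prop)
  · simp only [psi_fderiv]
    have := integrable_mul_phi (F := fun y : EE n => pe q (x + t • y) * y i) (by fun_prop)
    refine this.congr (Eventually.of_forall fun y => ?_)
    simp only; ring
  · exact integrable_mul_psi (by fun_prop)

/-- Mean value property for harmonic polynomials, with the kernel `phi`. -/
lemma mvp {n : ℕ} {p : MvPolynomial (Fin n) ℝ} (hp : pLap n p = 0) (x : EE n) (t : ℝ) :
    ∫ y, pe p (x + t • y) * phi y = pe p x * ∫ y : EE n, phi y := by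
  have hpc := pe_continuous p
  have hphi := (phi_contDiff (n := n)).continuous
  have hder : ∀ t₀ : ℝ, HasDerivAt (fun t : ℝ => ∫ y, pe p (x + t • y) * phi y) 0 t₀ := by
    intro t₀
    let F' : ℝ → EE n → ℝ := fun t y =>
      (∑ i, pe (MvPolynomial.pderiv i p) (x + t • y) * y i) * phi y
    have hGc : Continuous fun z : ℝ × EE n =>
        ∑ i, pe (MvPolynomial.pderiv i p) (x + z.1 • z.2) * z.2 i := by
      refine continuous_finsetSum _ fun i _ => ?_
      have := pe_continuous (MvPolynomial.pderiv i p)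
      fun_prop
    obtain ⟨K, hK⟩ := ((isCompact_closedBall t₀ 1).prod
      (isCompact_closedBall (0 : EE n) 1)).exists_bound_of_continuousOn hGc.continuousOn
    have hF't : ∀ t : ℝ, Continuous fun y : EE n =>
        ∑ i, pe (MvPolynomial.pderiv i p) (x + t • y) * y i := by
      intro t
      refine continuous_finsetSum _ fun i _ => ?_
      have := pe_continuous (MvPolynomial.pderiv i p)
      fun_prop
    have hzero : ∫ y, F' t₀ y = 0 := by
      simp only [F', Finset.sum_mul]
      rw [integral_finsetSum]
      · simp only [ibp]
        rw [Finset.sum_neg_distrib, ← Finset.mul_sum, ← integral_finsetSum]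
        · have : ∀ y : EE n, ∑ i, pe (MvPolynomial.pderiv i (MvPolynomial.pderiv i p)) (x + t₀ • y)
              * psi y = 0 := by
            intro y
            rw [← Finset.sum_mul]
            have : ∑ i, pe (MvPolynomial.pderiv i (MvPolynomial.pderiv i p)) (x + t₀ • y)
                = pe (pLap n p) (x + t₀ • y) := by
              rw [pLap_apply]; simp [pe]
            rw [this, hp]; simp [pe]
          simp [this]
        · intro i _
          have := pe_continuous (MvPolynomial.pderiv i (MvPolynomial.pderiv i p))
          exact integrable_mul_psi (by fun_prop)
      · intro i _
        have := pe_continuous (MvPolynomial.pderiv i p)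
        exact integrable_mul_phi (by fun_prop)
    rw [← hzero]
    refine (hasDerivAt_integral_of_dominated_loc_of_deriv_le (F' := F') (s := ball t₀ 1)
      (bound := fun y => K * phi y) (ball_mem_nhds _ one_pos) ?_ ?_ ?_ ?_ ?_ ?_).2
    · refine Eventually.of_forall fun t => Continuous.aestronglyMeasurable ?_
      fun_prop
    · exact integrable_mul_phi (by fun_prop)
    · exact ((hF't t₀).mul hphi).aestronglyMeasurable
    · refine Eventually.of_forall fun y t ht => ?_
      by_cases hy : y ∈ closedBall (0 : EE n) 1
      · simp only [F', norm_mul, Real.norm_of_nonneg (phi_nonneg y)]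
        refine mul_le_mul_of_nonneg_right ?_ (phi_nonneg y)
        exact hK (t, y) ⟨ball_subset_closedBall ht, hy⟩
      · simp [F', phi_zero hy]
    · exact integrable_mul_phi continuous_const
    · refine Eventually.of_forall fun y t _ => ?_
      have h1 : HasDerivAt (fun t : ℝ => x + t • y) y t := by
        simpa using ((hasDerivAt_id t).smul_const y).const_add x
      have h2 := (pe_hasFDerivAt p (x + t • y)).comp_hasDerivAt t h1
      have h3 := h2.mul_const (phi y)
      refine h3.congr_deriv ?_
      simp [F']
  have hc := is_const_of_deriv_eq_zero (fun t => (hder t).differentiableAt)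
    (fun t => (hder t).deriv) t 0
  simp only [zero_smul, add_zero, integral_const_mul] at hc
  exact hc

end BPZ

namespace BPZ

open Topology

lemma stone {n : ℕ} {F : EE n → ℝ} (hF : Continuous F) (a : EE n) (R : ℝ) {ε : ℝ} (hε : 0 < ε) :
    ∃ p : MvPolynomial (Fin n) ℝ, ∀ x ∈ closedBall a R, |pe p x - F x| < ε := by
  let co : Fin n → C(EE n, ℝ) := fun i => ⟨fun x => x i, by fun_prop⟩
  let Φ : MvPolynomial (Fin n) ℝ →ₐ[ℝ] C(EE n, ℝ) := MvPolynomial.aeval co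
  have hΦ : ∀ p x, Φ p x = pe p x := by
    intro p x
    induction p using MvPolynomial.induction_on with
    | C r => simp [Φ, pe]
    | add p q hp hq => simp [pe] at hp hq ⊢; rw [hp, hq]
    | mul_X p i hp => 
      rw [map_mul, ContinuousMap.mul_apply, hp, pe_mul]
      simp [Φ, pe, co]
  have hsep : (Φ.range).SeparatesPoints := by
    intro x y hxy
    have : ∃ i, x i ≠ y i := by
      by_contra! h
      exact hxy (by ext i; exact h i)
    obtain ⟨i, hi⟩ := this
    refine ⟨_, ⟨Φ (MvPolynomial.X i), ⟨_, rfl⟩, rfl⟩, ?_⟩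
    simpa [hΦ, pe] using hi
  obtain ⟨g, ⟨p, rfl⟩, hg⟩ :=
    ContinuousMap.exists_mem_subalgebra_near_continuous_of_isCompact_of_separatesPoints hsep
      ⟨F, hF⟩ (isCompact_closedBall a R) hε
  refine ⟨p, fun x hx => ?_⟩
  have := hg x hx
  rw [← hΦ]
  exact this

lemma rLap_sub {n : ℕ} {u v : EE n → ℝ} (hu : Continuous u) (hv : Continuous v) (r : ℝ) (x : EE n) :
    rLap n r (fun y => u y - v y) x = rLap n r u x - rLap n r v x := by
  simp only [rLap, setAverage_eq, smul_eq_mul]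
  rw [integral_sub (integrableOn_ball x r hu) (integrableOn_ball x r hv)]
  ring

lemma approx {n : ℕ} (hn : 0 < n) {F : EE n → ℝ} (hF : Continuous F) {a : EE n} {R : ℝ}
    (hR : 0 < R) (hlap : ∀ x ∈ ball a R, Tendsto (fun r => rLap n r F x) (𝓝[>] 0) (𝓝 0))
    {ε : ℝ} (hε : 0 < ε) :
    ∃ h : MvPolynomial (Fin n) ℝ, pLap n h = 0 ∧ ∀ x ∈ closedBall a R, |F x - pe h x| ≤ ε := by
  obtain ⟨p, hp⟩ := stone hF a R hε
  obtain ⟨h, hh, hhp⟩ := dirichlet_poly hn p a hR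
  have hc := pe_continuous h
  have h1 : ∀ x ∈ closedBall a R, F x - pe h x ≤ ε := by
    refine max_principle hn hR (hF.sub hc).continuousOn (fun x hx => ?_) fun x hx => ?_
    · simp only [rLap_sub hF hc]
      simpa using (hlap x hx).sub (rLap_pe hh x)
    · have := abs_lt.1 (hp x (sphere_subset_closedBall hx))
      rw [hhp x hx]; linarith
  have h2 : ∀ x ∈ closedBall a R, pe h x - F x ≤ ε := by
    refine max_principle hn hR (hc.sub hF).continuousOn (fun x hx => ?_) fun x hx => ?_
    · simp only [rLap_sub hc hF]
      simpa using (rLap_pe hh x).sub (hlap x hx)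
    · have := abs_lt.1 (hp x (sphere_subset_closedBall hx))
      rw [hhp x hx]; linarith
  refine ⟨h, hh, fun x hx => abs_le.2 ⟨?_, h1 x hx⟩⟩
  linarith [h2 x hx]

lemma mvp_F {n : ℕ} (hn : 0 < n) {F : EE n → ℝ} (hF : Continuous F) {a : EE n} {R : ℝ}
    (hR : 0 < R) (hlap : ∀ x ∈ ball a R, Tendsto (fun r => rLap n r F x) (𝓝[>] 0) (𝓝 0))
    {x : EE n} (hx : x ∈ ball a (R / 2)) :
    ∫ y, F (x + (R / 2) • y) * phi y = F x * ∫ y : EE n, phi y := by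
  set C := ∫ y : EE n, phi y with hC
  have hCpos : 0 < C := phi_int_pos hn
  rw [← sub_eq_zero, ← abs_nonpos_iff]
  refine le_of_forall_pos_le_add fun η hη => ?_
  obtain ⟨h, hh, happ⟩ := approx hn hF hR hlap (ε := η / (2 * C)) (by positivity)
  have hm := mvp hh x (R / 2)
  rw [← hC] at hm
  have hc := pe_continuous h
  have hxR : x ∈ closedBall a R := by
    simp at hx ⊢; linarith
  have e2 : |∫ y, (F (x + (R / 2) • y) - pe h (x + (R / 2) • y)) * phi y| ≤ η / (2 * C) * C := by
    rw [hC, ← integral_const_mul, ← Real.norm_eq_abs, ← hC]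
    refine norm_integral_le_of_norm_le (integrable_mul_phi continuous_const)
      (Eventually.of_forall fun y => ?_)
    by_cases hy : y ∈ closedBall (0 : EE n) 1
    · rw [norm_mul, Real.norm_of_nonneg (phi_nonneg y)]
      refine mul_le_mul_of_nonneg_right ?_ (phi_nonneg y)
      refine happ _ ?_
      rw [mem_closedBall, dist_eq_norm]
      rw [mem_ball, dist_eq_norm] at hx
      have hy' : ‖y‖ ≤ 1 := by simpa using hy
      calc ‖x + (R / 2) • y - a‖ = ‖(x - a) + (R / 2) • y‖ := by congr 1; abel
        _ ≤ ‖x - a‖ + ‖(R / 2) • y‖ := norm_add_le _ _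
        _ ≤ R / 2 + R / 2 * 1 := by
          rw [norm_smul, Real.norm_of_nonneg (by positivity)]
          gcongr
        _ = R := by ring
    · simp [phi_zero hy]
  have e3 : |(F x - pe h x) * C| ≤ η / (2 * C) * C := by
    rw [abs_mul, abs_of_pos hCpos]
    exact mul_le_mul_of_nonneg_right (happ x hxR) hCpos.le
  have e4 : η / (2 * C) * C = η / 2 := by field_simp
  rw [e4] at e2 e3
  change |(∫ y, F (x + (R / 2) • y) * phi y) - F x * C| ≤ 0 + η
  have e1' : (∫ y, F (x + (R / 2) • y) * phi y) - F x * C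
      = (∫ y, (F (x + (R / 2) • y) - pe h (x + (R / 2) • y)) * phi y) - (F x - pe h x) * C := by
    simp only [sub_mul]
    rw [integral_sub (integrable_mul_phi (by fun_prop)) (integrable_mul_phi (by fun_prop)), hm]
    ring
  rw [e1']
  refine (abs_sub _ _).trans ?_
  linarith

lemma smooth_F {n : ℕ} (hn : 0 < n) {F : EE n → ℝ} (hF : Continuous F) {a : EE n} {R : ℝ}
    (hR : 0 < R) (hlap : ∀ x ∈ ball a R, Tendsto (fun r => rLap n r F x) (𝓝[>] 0) (𝓝 0)) :
    ContDiffOn ℝ (⊤ : ℕ∞) F (ball a (R / 2)) := by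
  set C := ∫ y : EE n, phi y with hC
  have hCpos : 0 < C := phi_int_pos hn
  set t := R / 2 with ht
  have htpos : 0 < t := by positivity
  let g : EE n → ℝ := fun w => phi (t⁻¹ • w)
  have hg : ContDiff ℝ (⊤ : ℕ∞) g := phi_contDiff.comp (contDiff_const_smul _)
  have hgs : HasCompactSupport g := by
    refine HasCompactSupport.intro (isCompact_closedBall (0 : EE n) t) fun w hw => ?_
    refine phi_zero ?_
    simp [norm_smul, abs_of_pos htpos] at hw ⊢
    rw [← div_eq_inv_mul, lt_div_iff₀ htpos]
    linarith
  have hconv := hgs.contDiff_convolution_right (ContinuousLinearMap.mul ℝ ℝ)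
    (μ := volume) hF.locallyIntegrable hg
  refine ((hconv.mul (contDiff_const (c := (t ^ n)⁻¹ * C⁻¹))).contDiffOn).congr fun x hx => ?_
  have hm := mvp_F hn hF hR hlap hx
  rw [← hC, ← ht] at hm
  have e : ∫ y, F (x + t • y) * phi y
      = (t ^ n)⁻¹ * ∫ z, F z * phi (t⁻¹ • (x - z)) := by
    have h1 : ∀ y : EE n, F (x + t • y) * phi y
        = (fun w => (fun z => F z * phi (t⁻¹ • (x - z))) (x + w)) (t • y) := by
      intro y
      have : phi (t⁻¹ • (x - (x + t • y))) = phi y := by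
        rw [sub_add_cancel_left, smul_neg, smul_smul, inv_mul_cancel₀ htpos.ne', one_smul]
        simp [phi]
      simp only [this]
    simp only [h1]
    rw [Measure.integral_comp_smul volume
      (fun w => (fun z => F z * phi (t⁻¹ • (x - z))) (x + w)),
      integral_add_left_eq_self (μ := volume) (fun z => F z * phi (t⁻¹ • (x - z))) x]
    simp [abs_of_pos htpos]
  have e2 : MeasureTheory.convolution F g (ContinuousLinearMap.mul ℝ ℝ) volume x
      = ∫ z, F z * phi (t⁻¹ • (x - z)) := rfl
  rw [e2]
  rw [e] at hm
  field_simp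
  field_simp at hm
  linarith

end BPZ

/-- Blaschke–Privaloff–Zaremba theorem in `ℝⁿ`. -/
theorem blaschke_privaloff_zaremba (n : ℕ)
    (Ω : Set (EuclideanSpace ℝ (Fin n))) (hΩ : IsOpen Ω)
    (f : EuclideanSpace ℝ (Fin n) → ℝ) (hf : ContinuousOn f Ω)
    (hamv : ∀ x ∈ Ω,
      Tendsto (fun r => rLap n r f x) (nhdsWithin 0 (Set.Ioi 0)) (nhds 0)) :
    ContDiffOn ℝ (⊤ : ℕ∞) f Ω ∧ ∀ x ∈ Ω, classicalLaplacian n f x = 0 := by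
  rcases Nat.eq_zero_or_pos n with rfl | hn
  · refine ⟨?_, fun x _ => by simp [classicalLaplacian]⟩
    have : f = fun _ => f 0 := by
      funext x; rw [Subsingleton.elim x 0]
    rw [this]
    exact contDiffOn_const
  have hsm : ∀ x ∈ Ω, ContDiffAt ℝ (⊤ : ℕ∞) f x := by
    intro a ha
    obtain ⟨R, hR, hRΩ⟩ := Metric.nhds_basis_closedBall.mem_iff.1 (hΩ.mem_nhds ha)
    obtain ⟨F, hFr⟩ := ContinuousMap.exists_restrict_eq (isClosed_closedBall (x := a) (ε := R))
      ⟨(closedBall a R).domRestrict f, (hf.mono hRΩ).domRestrict⟩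
    have hFf : ∀ y ∈ closedBall a R, F y = f y := fun y hy =>
      congrArg (fun g : C(closedBall a R, ℝ) => g ⟨y, hy⟩) hFr
    have hlap : ∀ x ∈ ball a R,
        Tendsto (fun r => rLap n r F x) (nhdsWithin 0 (Set.Ioi 0)) (nhds 0) := by
      intro x hx
      refine (hamv x (hRΩ (ball_subset_closedBall hx))).congr' ?_
      obtain ⟨δ, hδ, hδb⟩ := Metric.isOpen_iff.1 isOpen_ball x hx
      filter_upwards [Ioo_mem_nhdsGT hδ] with r hr
      have hsub : ball x r ⊆ closedBall a R :=
        (ball_subset_ball hr.2.le).trans (hδb.trans ball_subset_closedBall)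
      simp only [rLap, setAverage_eq]
      rw [hFf x (ball_subset_closedBall hx),
        setIntegral_congr_fun measurableSet_ball fun y hy => hFf y (hsub hy)]
    have h1 := BPZ.smooth_F hn F.continuous hR hlap
    have h2 : ContDiffAt ℝ (⊤ : ℕ∞) F a :=
      h1.contDiffAt (ball_mem_nhds _ (by positivity))
    refine h2.congr_of_eventuallyEq ?_
    filter_upwards [closedBall_mem_nhds a hR] with y hy
    exact (hFf y hy).symm
  refine ⟨fun x hx => (hsm x hx).contDiffWithinAt, fun x hx => ?_⟩
  have h1 := BPZ.rLap_tendsto ((hsm x hx).of_le (m := 2) (by exact WithTop.coe_le_coe.2 (le_top : (2 : ℕ∞) ≤ ⊤)))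
  have h2 := tendsto_nhds_unique h1 (hamv x hx)
  exact (mul_eq_zero.1 h2).resolve_left (BPZ.cc_pos hn).ne'
end

section
/- Mean value property characterization: a continuous function f on an open set Ω ⊂ ℝⁿ satisfying f(x) = ⨍_{B_r(x)} f dλ for every x ∈ Ω and every r with B_r(x) ⊂ Ω (equivalently, Δ_r f(x) = 0 for all such x, r) is harmonic in Ω. -/
open MeasureTheory Metric

lemma radial_mean {n : ℕ} (f : EuclideanSpace ℝ (Fin n) → ℝ) (x : EuclideanSpace ℝ (Fin n))
    (R : ℝ) (hR : 0 < R) (hf : ContinuousOn f (closedBall x R))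
    (hmv : ∀ r : ℝ, 0 < r → r ≤ R → f x = ⨍ y in ball x r, f y)
    (g : ℝ → ℝ) (hg : Continuous g) (hg0 : ∀ t, R ≤ t → g t = 0) :
    ∫ y in closedBall x R, f y * g (dist y x) = f x * ∫ y, g (dist y x) := by
  obtain ⟨M, hM⟩ := (isCompact_closedBall x R).exists_bound_of_continuousOn hf
  have hMf : ∀ y ∈ closedBall x R, 0 ≤ f y + M := by
    intro y hy
    have := hM y hy
    rw [Real.norm_eq_abs] at this
    linarith [neg_abs_le (f y)]
  have hfi : IntegrableOn f (closedBall x R) := hf.integrableOn_compact (isCompact_closedBall x R)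
  have hfb : IntegrableOn f (ball x R) := hfi.mono_set ball_subset_closedBall
  have hxm : x ∈ closedBall x R := mem_closedBall_self hR.le
  have hd : Measurable (fun y : EuclideanSpace ℝ (Fin n) => dist y x) := by fun_prop
  set V : Measure (EuclideanSpace ℝ (Fin n)) := volume.restrict (ball x R) with hV
  have : IsFiniteMeasure V := ⟨by rw [hV, Measure.restrict_apply_univ]; exact measure_ball_lt_top⟩
  have hfM : Integrable (fun y => f y + M) V := hfb.add (integrable_const M)
  set μ := V.withDensity (fun y => ENNReal.ofReal (f y + M)) with hμ
  set ν := ENNReal.ofReal (f x + M) • V with hν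
  have hmeas : AEMeasurable (fun y => ENNReal.ofReal (f y + M)) V :=
    hfM.1.aemeasurable.ennreal_ofReal
  have key : ∀ r, 0 < r → r ≤ R → μ (ball x r) = ν (ball x r) := by
    intro r hr hrR
    have hsub : ball x r ⊆ ball x R := ball_subset_ball hrR
    have hres : V.restrict (ball x r) = volume.restrict (ball x r) := by
      rw [hV, Measure.restrict_restrict measurableSet_ball, Set.inter_eq_left.mpr hsub]
    have h1 : Integrable f (volume.restrict (ball x r)) := hfb.mono_set hsub
    have : IsFiniteMeasure (volume.restrict (ball x r)) :=
      ⟨by rw [Measure.restrict_apply_univ]; exact measure_ball_lt_top⟩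
    have hV' : V (ball x r) = volume (ball x r) := by
      rw [hV, Measure.restrict_apply measurableSet_ball, Set.inter_eq_left.mpr hsub]
    have h1M : Integrable (fun y => f y + M) (volume.restrict (ball x r)) :=
      h1.add (integrable_const M)
    rw [hμ, withDensity_apply _ measurableSet_ball, hres, hν, Measure.smul_apply, hV', smul_eq_mul,
      ← ofReal_integral_eq_lintegral_ofReal h1M,
      integral_add h1 (integrable_const M)]
    · have h2 := hmv r hr hrR
      have hpos : 0 < volume.real (ball x r) :=
        ENNReal.toReal_pos (measure_ball_pos _ _ hr).ne' measure_ball_lt_top.ne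
      rw [setAverage_eq, smul_eq_mul, eq_inv_mul_iff_mul_eq₀ hpos.ne'] at h2
      rw [← h2, integral_const, smul_eq_mul, measureReal_restrict_apply_univ, ← mul_add,
        ENNReal.ofReal_mul hpos.le, mul_comm, Measure.real, ENNReal.ofReal_toReal measure_ball_lt_top.ne]
    · refine (ae_restrict_iff' measurableSet_ball).mpr (.of_forall fun y hy => ?_)
      exact hMf y (ball_subset_closedBall (hsub hy))
  have keyall : ∀ r, μ (ball x r) = ν (ball x r) := by
    intro r
    rcases le_or_gt r 0 with h | h
    · simp [ball_eq_empty.mpr h]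
    rcases le_total r R with h' | h'
    · exact key r h h'
    have e : ∀ ρ : Measure (EuclideanSpace ℝ (Fin n)), ρ ≪ V → ρ (ball x r) = ρ (ball x R) := by
      intro ρ hρ
      refine measure_congr ?_
      apply hρ.ae_eq
      have : ∀ᵐ y ∂V, y ∈ ball x R := ae_restrict_mem measurableSet_ball
      filter_upwards [this] with y hy
      exact propext ⟨fun _ => hy, fun _ => ball_subset_ball h' hy⟩
    rw [e μ (withDensity_absolutelyContinuous _ _), e ν Measure.smul_absolutelyContinuous]
    exact key R hR le_rfl
  have : IsFiniteMeasure μ := isFiniteMeasure_withDensity_ofReal hfM.2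
  have hbd : ∀ ρ : Measure (EuclideanSpace ℝ (Fin n)), ∀ r,
      ρ.map (fun y => dist y x) (Set.Iio r) = ρ (ball x r) := by
    intro ρ r
    rw [Measure.map_apply hd measurableSet_Iio]; rfl
  have huniv : ∀ ρ : Measure (EuclideanSpace ℝ (Fin n)), ρ ≪ V → ρ Set.univ = ρ (ball x R) := by
    intro ρ hρ
    refine measure_congr ?_
    apply hρ.ae_eq
    have : ∀ᵐ y ∂V, y ∈ ball x R := ae_restrict_mem measurableSet_ball
    filter_upwards [this] with y hy
    exact propext ⟨fun _ => hy, fun _ => trivial⟩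
  have hmap : μ.map (fun y => dist y x) = ν.map (fun y => dist y x) := by
    refine ext_of_generate_finite _ (borel_eq_generateFrom_Iio ℝ ▸ BorelSpace.measurable_eq)
      isPiSystem_Iio ?_ ?_
    · rintro _ ⟨r, rfl⟩
      rw [hbd, hbd, keyall]
    · rw [Measure.map_apply hd .univ, Measure.map_apply hd .univ, Set.preimage_univ,
        huniv μ (withDensity_absolutelyContinuous _ _), huniv ν Measure.smul_absolutelyContinuous, keyall]
  have hint : ∫ y, g (dist y x) ∂μ = ∫ y, g (dist y x) ∂ν := by
    rw [← integral_map hd.aemeasurable hg.aestronglyMeasurable, hmap,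
      integral_map hd.aemeasurable hg.aestronglyMeasurable]
  rw [hμ, integral_withDensity_eq_integral_toReal_smul₀ hmeas (by simp), hν, integral_smul_measure,
    ENNReal.toReal_ofReal (hMf x hxm), smul_eq_mul] at hint
  have hgc : Continuous (fun y : EuclideanSpace ℝ (Fin n) => g (dist y x)) := by fun_prop
  have hgi : Integrable (fun y => g (dist y x)) V :=
    (hgc.continuousOn.integrableOn_compact (isCompact_closedBall x R)).mono_set ball_subset_closedBall
  have hfgi : Integrable (fun y => f y * g (dist y x)) V :=
    ((hf.mul hgc.continuousOn).integrableOn_compact (isCompact_closedBall x R)).mono_set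
      ball_subset_closedBall
  have h3 : ∫ y, (ENNReal.ofReal (f y + M)).toReal • g (dist y x) ∂V
      = ∫ y, (f y * g (dist y x) + M * g (dist y x)) ∂V := by
    refine setIntegral_congr_fun measurableSet_ball fun y hy => ?_
    simp only [smul_eq_mul]
    rw [ENNReal.toReal_ofReal (hMf y (ball_subset_closedBall hy))]; ring
  rw [h3, integral_add hfgi (hgi.const_mul M), integral_const_mul] at hint
  have h4 : ∫ y, g (dist y x) ∂V = ∫ y, g (dist y x) := by
    refine setIntegral_eq_integral_of_forall_compl_eq_zero fun y hy => hg0 _ ?_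
    simpa using hy
  have h5 : ∫ y in closedBall x R, f y * g (dist y x) = ∫ y, f y * g (dist y x) ∂V := by
    refine (setIntegral_eq_of_subset_of_forall_sdiff_eq_zero measurableSet_closedBall
      ball_subset_closedBall fun y hy => ?_)
    rw [hg0 _ (by simpa using hy.2), mul_zero]
  rw [h5, ← h4]; linarith

open scoped Convolution Topology

lemma classicalLaplacian_congr {n : ℕ} {f g : EuclideanSpace ℝ (Fin n) → ℝ}
    {x : EuclideanSpace ℝ (Fin n)} (h : f =ᶠ[𝓝 x] g) :
    classicalLaplacian n f x = classicalLaplacian n g x := by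
  unfold classicalLaplacian
  refine Finset.sum_congr rfl fun i _ => ?_
  have h1 : (fun y => fderiv ℝ f y (EuclideanSpace.single i 1)) =ᶠ[𝓝 x]
      (fun y => fderiv ℝ g y (EuclideanSpace.single i 1)) := by
    filter_upwards [h.fderiv (𝕜 := ℝ)] with y hy
    rw [hy]
  rw [h1.fderiv_eq]

lemma fderiv_conv {n : ℕ} {F φ : EuclideanSpace ℝ (Fin n) → ℝ} (hF : LocallyIntegrable F)
    (hφ : ContDiff ℝ 1 φ) (hc : HasCompactSupport φ) (v x : EuclideanSpace ℝ (Fin n)) :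
    fderiv ℝ (F ⋆[ContinuousLinearMap.mul ℝ ℝ, volume] φ) x v =
      (F ⋆[ContinuousLinearMap.mul ℝ ℝ, volume] (fun a => fderiv ℝ φ a v)) x := by
  rw [(hc.hasFDerivAt_convolution_right (ContinuousLinearMap.mul ℝ ℝ) hF hφ x).fderiv]
  exact convolution_precompR_apply _ hF (hc.fderiv ℝ) (hφ.continuous_fderiv one_ne_zero) x v

lemma laplacian_conv {n : ℕ} {F φ : EuclideanSpace ℝ (Fin n) → ℝ} (hF : LocallyIntegrable F)
    (hφ : ContDiff ℝ (⊤ : ℕ∞) φ) (hc : HasCompactSupport φ) (x : EuclideanSpace ℝ (Fin n)) :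
    classicalLaplacian n (F ⋆[ContinuousLinearMap.mul ℝ ℝ, volume] φ) x =
      (F ⋆[ContinuousLinearMap.mul ℝ ℝ, volume] (classicalLaplacian n φ)) x := by
  have hd1 : ∀ v, ContDiff ℝ (⊤ : ℕ∞) (fun a => fderiv ℝ φ a v) := fun v =>
    (hφ.fderiv_right (m := (⊤ : ℕ∞)) (by simp)).clm_apply contDiff_const
  have hc1 : ∀ v, HasCompactSupport (fun a => fderiv ℝ φ a v) := fun v => hc.fderiv_apply ℝ v
  have hd2 : ∀ v, Continuous (fun a => fderiv ℝ (fun y => fderiv ℝ φ y v) a v) := fun v =>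
    (((hd1 v).fderiv_right (m := (⊤ : ℕ∞)) (by simp)).clm_apply contDiff_const).continuous
  have e : ∀ v, (fun y => fderiv ℝ (F ⋆[ContinuousLinearMap.mul ℝ ℝ, volume] φ) y v) =
      (F ⋆[ContinuousLinearMap.mul ℝ ℝ, volume] (fun a => fderiv ℝ φ a v)) := fun v =>
    funext fun y => fderiv_conv hF (hφ.of_le (by exact_mod_cast le_top)) hc v y
  unfold classicalLaplacian
  simp_rw [e]
  rw [Finset.sum_congr rfl fun i _ => fderiv_conv hF ((hd1 _).of_le (by exact_mod_cast le_top))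
    (hc1 _) _ x]
  simp only [convolution_def]
  rw [← integral_finsetSum]
  · refine integral_congr_ae (.of_forall fun t => ?_)
    simp
  · intro i _
    exact ((hc1 (EuclideanSpace.single i 1)).fderiv_apply ℝ (EuclideanSpace.single i 1)).convolutionExists_right
      (ContinuousLinearMap.mul ℝ ℝ) hF (hd2 _) x

lemma laplacian_radial {n : ℕ} (h : ℝ → ℝ) (hh : ContDiff ℝ (⊤ : ℕ∞) h)
    (x : EuclideanSpace ℝ (Fin n)) :
    classicalLaplacian n (fun y => h (‖y‖ ^ 2)) x =
      4 * deriv (deriv h) (‖x‖ ^ 2) * ‖x‖ ^ 2 + 2 * n * deriv h (‖x‖ ^ 2) := by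
  have hh' : ContDiff ℝ (⊤ : ℕ∞) (deriv h) := (contDiff_infty_iff_deriv.mp hh).2
  have d0 : ∀ s, HasDerivAt h (deriv h s) s := fun s =>
    (hh.differentiable (by simp) s).hasDerivAt
  have d1 : ∀ s, HasDerivAt (deriv h) (deriv (deriv h) s) s := fun s =>
    (hh'.differentiable (by simp) s).hasDerivAt
  have dn : ∀ y : EuclideanSpace ℝ (Fin n),
      HasFDerivAt (fun y : EuclideanSpace ℝ (Fin n) => ‖y‖ ^ 2) (2 • innerSL ℝ y) y := fun y =>
    (hasStrictFDerivAt_norm_sq y).hasFDerivAt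
  have e1 : ∀ i : Fin n, (fun y => fderiv ℝ (fun y : EuclideanSpace ℝ (Fin n) => h (‖y‖ ^ 2)) y
      (EuclideanSpace.single i 1)) = fun y => deriv h (‖y‖ ^ 2) * (2 * y i) := by
    intro i; funext y
    have := ((d0 (‖y‖ ^ 2)).comp_hasFDerivAt y (dn y)).fderiv
    rw [show (fun y : EuclideanSpace ℝ (Fin n) => h (‖y‖ ^ 2)) = h ∘ (fun y => ‖y‖ ^ 2) from rfl, this]
    simp [EuclideanSpace.inner_single_right]
  unfold classicalLaplacian
  simp_rw [e1]
  have e2 : ∀ i : Fin n, fderiv ℝ (fun y : EuclideanSpace ℝ (Fin n) => deriv h (‖y‖ ^ 2) * (2 * y i)) x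
      (EuclideanSpace.single i 1) =
      4 * deriv (deriv h) (‖x‖ ^ 2) * (x i) ^ 2 + 2 * deriv h (‖x‖ ^ 2) := by
    intro i
    have p1 := (d1 (‖x‖ ^ 2)).comp_hasFDerivAt x (dn x)
    have p2 : HasFDerivAt (fun y : EuclideanSpace ℝ (Fin n) => 2 * y i)
        ((2 : ℝ) • (EuclideanSpace.proj i : EuclideanSpace ℝ (Fin n) →L[ℝ] ℝ)) x :=
      ((EuclideanSpace.proj i : EuclideanSpace ℝ (Fin n) →L[ℝ] ℝ).hasFDerivAt).const_mul 2
    have p3 := (p1.mul p2).fderiv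
    have p4 : (fun y : EuclideanSpace ℝ (Fin n) => deriv h (‖y‖ ^ 2) * (2 * y i)) =
      (deriv h ∘ fun y => ‖y‖ ^ 2) * (fun y => 2 * y i) := rfl
    rw [p4, p3]
    simp [EuclideanSpace.inner_single_right]
    ring
  simp_rw [e2]
  rw [Finset.sum_add_distrib, ← Finset.mul_sum, ← EuclideanSpace.real_norm_sq_eq]
  simp
  ring

lemma compact_supp {n : ℕ} {R : ℝ} (hR : 0 < R) {h : ℝ → ℝ} (h0 : ∀ s, R ^ 2 / 4 ≤ s → h s = 0) :
    HasCompactSupport (fun y : EuclideanSpace ℝ (Fin n) => h (‖y‖ ^ 2)) := by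
  refine HasCompactSupport.intro (isCompact_closedBall 0 R) fun y hy => h0 _ ?_
  have : R < ‖y‖ := by simpa using hy
  nlinarith

lemma exists_profile (n : ℕ) {R : ℝ} (hR : 0 < R) : ∃ h : ℝ → ℝ, ContDiff ℝ (⊤ : ℕ∞) h ∧
    (∀ s, R ^ 2 / 4 ≤ s → h s = 0) ∧ ∫ y : EuclideanSpace ℝ (Fin n), h (‖y‖ ^ 2) = 1 := by
  set k : ℝ → ℝ := fun s => expNegInvGlue (R ^ 2 / 4 - s) with hk
  have hks : ContDiff ℝ (⊤ : ℕ∞) k := expNegInvGlue.contDiff.comp (contDiff_const.sub contDiff_id)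
  have k0 : ∀ s, R ^ 2 / 4 ≤ s → k s = 0 := fun s hs =>
    expNegInvGlue.zero_of_nonpos (by linarith)
  have hcont : Continuous (fun y : EuclideanSpace ℝ (Fin n) => k (‖y‖ ^ 2)) :=
    hks.continuous.comp (by fun_prop)
  have hpos : 0 < ∫ y : EuclideanSpace ℝ (Fin n), k (‖y‖ ^ 2) := by
    refine hcont.integral_pos_of_hasCompactSupport_nonneg_nonzero (x := 0) (compact_supp hR k0)
      (fun y => expNegInvGlue.nonneg _) ?_
    refine (expNegInvGlue.pos_of_pos ?_).ne'
    simp; positivity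
  refine ⟨fun s => (∫ y : EuclideanSpace ℝ (Fin n), k (‖y‖ ^ 2))⁻¹ * k s, contDiff_const.mul hks,
    fun s hs => by simp [k0 s hs], ?_⟩
  rw [integral_const_mul, inv_mul_cancel₀ hpos.ne']

lemma integral_laplacian_zero {n : ℕ} {φ : EuclideanSpace ℝ (Fin n) → ℝ}
    (hφ : ContDiff ℝ (⊤ : ℕ∞) φ) (hc : HasCompactSupport φ) :
    ∫ y, classicalLaplacian n φ y = 0 := by
  have e : ∀ ψ : EuclideanSpace ℝ (Fin n) → ℝ, ∀ x,
      ((fun _ => (1 : ℝ)) ⋆[ContinuousLinearMap.mul ℝ ℝ, volume] ψ) x = ∫ y, ψ y := by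
    intro ψ x
    simp only [convolution_def, ContinuousLinearMap.mul_apply', one_mul]
    exact integral_sub_left_eq_self ψ volume x
  have h1 := laplacian_conv (F := fun _ => (1 : ℝ)) (continuous_const.locallyIntegrable) hφ hc 0
  rw [e, show ((fun _ => (1 : ℝ)) ⋆[ContinuousLinearMap.mul ℝ ℝ, volume] φ) =
    fun _ => ∫ y, φ y from funext (e φ)] at h1
  rw [← h1]
  simp [classicalLaplacian]

lemma local_harmonic {n : ℕ} {f : EuclideanSpace ℝ (Fin n) → ℝ} {x₀ : EuclideanSpace ℝ (Fin n)}
    {R : ℝ} (hR : 0 < R) (hf : ContinuousOn f (closedBall x₀ (2 * R)))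
    (hmv : ∀ x ∈ ball x₀ R, ∀ r : ℝ, 0 < r → r ≤ R → f x = ⨍ y in ball x r, f y) :
    ContDiffAt ℝ (⊤ : ℕ∞) f x₀ ∧ classicalLaplacian n f x₀ = 0 := by
  obtain ⟨h, hh, h0, hI⟩ := exists_profile n hR
  set F := (closedBall x₀ (2 * R)).indicator f with hFdef
  have hF : LocallyIntegrable F :=
    ((integrable_indicator_iff measurableSet_closedBall).mpr
      (hf.integrableOn_compact (isCompact_closedBall _ _))).locallyIntegrable
  have conv : ∀ g : ℝ → ℝ, Continuous g → (∀ t, R ≤ t → g t = 0) → ∀ x ∈ ball x₀ R,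
      (F ⋆[ContinuousLinearMap.mul ℝ ℝ, volume] (fun y => g ‖y‖)) x = f x * ∫ y : EuclideanSpace ℝ (Fin n), g ‖y‖ := by
    intro g hg hg0 x hx
    have hsub : closedBall x R ⊆ closedBall x₀ (2 * R) := by
      apply closedBall_subset_closedBall'
      have := mem_ball.mp hx
      linarith
    have key := radial_mean f x R hR (hf.mono hsub) (hmv x hx) g hg hg0
    have e1 : ∫ y, g (dist y x) = ∫ y : EuclideanSpace ℝ (Fin n), g ‖y‖ := by
      simp_rw [dist_eq_norm]
      exact integral_sub_right_eq_self (fun y => g ‖y‖) x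
    rw [← e1, ← key, convolution_def]
    rw [← setIntegral_eq_integral_of_forall_compl_eq_zero (s := closedBall x R)]
    · refine setIntegral_congr_fun measurableSet_closedBall fun y hy => ?_
      simp only [ContinuousLinearMap.mul_apply', hFdef, Set.indicator_of_mem (hsub hy),
        dist_comm y x, dist_eq_norm x y]
    · intro y hy
      have : R < dist y x := by simpa using hy
      rw [dist_comm, dist_eq_norm] at this
      simp [hg0 _ this.le]
  have hφ : ContDiff ℝ (⊤ : ℕ∞) (fun y : EuclideanSpace ℝ (Fin n) => h (‖y‖ ^ 2)) :=
    hh.comp (contDiff_norm_sq ℝ)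
  have hc := compact_supp (n := n) hR h0
  have sq : ∀ t, R ≤ t → R ^ 2 / 4 < t ^ 2 := fun t ht => by nlinarith
  have hcont : Continuous fun t : ℝ => h (t ^ 2) := hh.continuous.comp (by fun_prop)
  have hEq : f =ᶠ[𝓝 x₀] (F ⋆[ContinuousLinearMap.mul ℝ ℝ, volume] (fun y => h (‖y‖ ^ 2))) := by
    filter_upwards [ball_mem_nhds x₀ hR] with x hx
    have := conv (fun t => h (t ^ 2)) hcont (fun t ht => h0 _ (sq t ht).le) x hx
    rw [this, hI, mul_one]
  refine ⟨?_, ?_⟩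
  · exact ((hc.contDiff_convolution_right (ContinuousLinearMap.mul ℝ ℝ) hF hφ).contDiffAt).congr_of_eventuallyEq hEq
  rw [classicalLaplacian_congr hEq, laplacian_conv hF hφ hc]
  have hh1 : ContDiff ℝ (⊤ : ℕ∞) (deriv h) := (contDiff_infty_iff_deriv.mp hh).2
  have hh2 : ContDiff ℝ (⊤ : ℕ∞) (deriv (deriv h)) := (contDiff_infty_iff_deriv.mp hh1).2
  have z0 : ∀ s, R ^ 2 / 4 < s → h =ᶠ[𝓝 s] fun _ => 0 := fun s hs => by
    filter_upwards [Ioi_mem_nhds hs] with t ht using h0 t (le_of_lt ht)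
  have z1 : ∀ s, R ^ 2 / 4 < s → deriv h s = 0 := fun s hs => by
    rw [(z0 s hs).deriv_eq]; simp
  have z2 : ∀ s, R ^ 2 / 4 < s → deriv (deriv h) s = 0 := fun s hs => by
    rw [(z0 s hs).deriv.deriv_eq]; simp
  have hI0 := integral_laplacian_zero hφ hc
  have eL := funext (laplacian_radial (n := n) h hh)
  rw [eL] at hI0 ⊢
  have c1 := hh1.continuous
  have c2 := hh2.continuous
  have := conv (fun t => 4 * deriv (deriv h) (t ^ 2) * t ^ 2 + 2 * n * deriv h (t ^ 2))
    (by fun_prop) (fun t ht => by simp [z1 _ (sq t ht), z2 _ (sq t ht)]) x₀ (mem_ball_self hR)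
  rw [this, hI0, mul_zero]

/-- A continuous function with the mean value property is harmonic. -/
theorem mean_value_property_implies_harmonic (n : ℕ)
    (Ω : Set (EuclideanSpace ℝ (Fin n))) (hΩ : IsOpen Ω)
    (f : EuclideanSpace ℝ (Fin n) → ℝ) (hf : ContinuousOn f Ω)
    (hmv : ∀ x ∈ Ω, ∀ r : ℝ, 0 < r → ball x r ⊆ Ω →
      f x = ⨍ y in ball x r, f y) :
    ContDiffOn ℝ (⊤ : ℕ∞) f Ω ∧ ∀ x ∈ Ω, classicalLaplacian n f x = 0 := by
  have main : ∀ x ∈ Ω, ContDiffAt ℝ (⊤ : ℕ∞) f x ∧ classicalLaplacian n f x = 0 := by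
    intro x hx
    obtain ⟨ε, hε, hsub⟩ := Metric.isOpen_iff.mp hΩ x hx
    have h1 : closedBall x (2 * (ε / 4)) ⊆ Ω :=
      (closedBall_subset_ball (by linarith)).trans hsub
    refine local_harmonic (R := ε / 4) (by linarith) (hf.mono h1) fun y hy r hr hrR => ?_
    have hy' := mem_ball.mp hy
    refine hmv y (hsub (mem_ball.mpr (by linarith))) r hr (Set.Subset.trans ?_ hsub)
    exact ball_subset_ball' (by linarith)
  exact ⟨fun x hx => (main x hx).1.contDiffWithinAt, fun x hx => (main x hx).2⟩
end
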